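/- Let (F_k)_{k∈ℕ} and F satisfy (H1), (H2') and (H3) with l = 0, with constants in (H2') and (H3) independent of k, and assume F_k → F locally uniformly on ℝⁿ×ℝ×ℝ×ℝⁿ×ℝ as k → ∞. Then the homogenized Hamiltonians F̄_k converge locally uniformly on ℝⁿ×ℝ to the homogenized Hamiltonian F̄. -/

import Mathlib

open MeasureTheory Topology Filter
open scoped RealInnerProductSpace

noncomputable section

/-- Euclidean space ℝⁿ. -/
abbrev Euc (n : ℕ) := EuclideanSpace ℝ (Fin n)

/-- Hamiltonians G = G(x, y, t, p_x, p_y). -/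
abbrev Ham (n : ℕ) := Euc n → ℝ → ℝ → Euc n → ℝ → ℝ

/-- The space of points (x, y, t) ∈ ℝⁿ×ℝ×ℝ. -/
abbrev Dom (n : ℕ) := Euc n × ℝ × ℝ

/-- The space of points ξ = (x, y, t, p_x, p_y). -/
abbrev Xi (n : ℕ) := Euc n × ℝ × ℝ × Euc n × ℝ

/-- The space of points (x, t) ∈ ℝⁿ×ℝ. -/
abbrev Dom2 (n : ℕ) := Euc n × ℝ

/-- The integer vector k viewed as a point of ℝⁿ. -/
def intVec {n : ℕ} (k : Fin n → ℤ) : Euc n := WithLp.toLp 2 (fun i => (k i : ℝ))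

/-- ∂φ/∂t for φ = φ(x,y,t). -/
def pdT {n : ℕ} (φ : Dom n → ℝ) (z : Dom n) : ℝ := fderiv ℝ φ z (0, 0, 1)

/-- ∂φ/∂y for φ = φ(x,y,t). -/
def pdY {n : ℕ} (φ : Dom n → ℝ) (z : Dom n) : ℝ := fderiv ℝ φ z (0, 1, 0)

/-- D_x φ for φ = φ(x,y,t). -/
def pdX {n : ℕ} (φ : Dom n → ℝ) (z : Dom n) : Euc n :=
  WithLp.toLp 2 (fun i => fderiv ℝ φ z (EuclideanSpace.single i 1, 0, 0))

/-- ∂φ/∂t for φ = φ(x,t). -/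
def pdT2 {n : ℕ} (φ : Dom2 n → ℝ) (z : Dom2 n) : ℝ := fderiv ℝ φ z (0, 1)

/-- D_x φ for φ = φ(x,t). -/
def pdX2 {n : ℕ} (φ : Dom2 n → ℝ) (z : Dom2 n) : Euc n :=
  WithLp.toLp 2 (fun i => fderiv ℝ φ z (EuclideanSpace.single i 1, 0))

/-- Viscosity subsolution of `w_t + G(x,y,t,D_x w,D_y w) + α w = λ` on ℝⁿ×ℝ×ℝ. -/
def ViscSub {n : ℕ} (G : Ham n) (α lam : ℝ) (u : Dom n → ℝ) : Prop :=
  UpperSemicontinuous u ∧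
  ∀ φ : Dom n → ℝ, ContDiff ℝ 1 φ → ∀ z : Dom n,
    IsLocalMax (fun w => u w - φ w) z →
    pdT φ z + G z.1 z.2.1 z.2.2 (pdX φ z) (pdY φ z) + α * u z ≤ lam

/-- Viscosity supersolution of `w_t + G(x,y,t,D_x w,D_y w) + α w = λ` on ℝⁿ×ℝ×ℝ. -/
def ViscSuper {n : ℕ} (G : Ham n) (α lam : ℝ) (u : Dom n → ℝ) : Prop :=
  LowerSemicontinuous u ∧
  ∀ φ : Dom n → ℝ, ContDiff ℝ 1 φ → ∀ z : Dom n,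
    IsLocalMin (fun w => u w - φ w) z →
    lam ≤ pdT φ z + G z.1 z.2.1 z.2.2 (pdX φ z) (pdY φ z) + α * u z

/-- Viscosity solution of `w_t + G(x,y,t,D_x w,D_y w) + α w = λ` on ℝⁿ×ℝ×ℝ. -/
def ViscSol {n : ℕ} (G : Ham n) (α lam : ℝ) (u : Dom n → ℝ) : Prop :=
  Continuous u ∧ ViscSub G α lam u ∧ ViscSuper G α lam u

/-- ℤⁿ-periodicity in x, 1-periodicity in y and t. -/
def STPeriodic {n : ℕ} (u : Dom n → ℝ) : Prop :=
  (∀ (k : Fin n → ℤ) (x : Euc n) (y t : ℝ), u (x + intVec k, y, t) = u (x, y, t)) ∧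
  (∀ x y t, u (x, y + 1, t) = u (x, y, t)) ∧
  (∀ x y t, u (x, y, t + 1) = u (x, y, t))

/-- Boundedness of a function on ℝⁿ×ℝ×ℝ. -/
def Bdd {n : ℕ} (u : Dom n → ℝ) : Prop := ∃ M, ∀ z, |u z| ≤ M

/-- (H1) : continuity and periodicity of the Hamiltonian. -/
def HypH1 {n : ℕ} (G : Ham n) : Prop :=
  Continuous (fun ξ : Xi n => G ξ.1 ξ.2.1 ξ.2.2.1 ξ.2.2.2.1 ξ.2.2.2.2) ∧
  (∀ (k : Fin n → ℤ) x y t px py, G (x + intVec k) y t px py = G x y t px py) ∧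
  (∀ x y t px py, G x (y + 1) t px py = G x y t px py) ∧
  (∀ x y t px py, G x y (t + 1) px py = G x y t px py)

/-- (H2) : coercivity in p_x at p_y = 0, with constants C₁, C₂ > 0. -/
def HypH2 {n : ℕ} (G : Ham n) (C₁ C₂ : ℝ) : Prop :=
  0 < C₁ ∧ 0 < C₂ ∧ ∀ x y t px, C₁ * ‖px‖ - C₂ ≤ G x y t px 0

/-- (H2') : coercivity in p_x, locally uniformly in p_y. -/
def HypH2' {n : ℕ} (F : Ham n) : Prop :=
  ∀ R : ℝ, 0 < R → ∃ C₁ C₂ : ℝ, 0 < C₁ ∧ 0 < C₂ ∧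
    ∀ x y t px py, |py| ≤ R → C₁ * ‖px‖ - C₂ ≤ F x y t px py

/-- (H3) : local Lipschitz continuity in (y,t,p_y) and a.e. bounds on the
partial derivatives ∂_y G, ∂_t G, ∂_{p_y} G. -/
def HypH3 {n : ℕ} (G : Ham n) (l C₃ C₄ C₅ : ℝ) : Prop :=
  0 ≤ C₃ ∧ 0 ≤ C₄ ∧ 0 ≤ C₅ ∧
  (∀ (x px : Euc n), LocallyLipschitz (fun q : ℝ × ℝ × ℝ => G x q.1 q.2.1 px q.2.2)) ∧
  (∀ᵐ ξ ∂(volume : Measure (Xi n)),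
    |deriv (fun y => G ξ.1 y ξ.2.2.1 ξ.2.2.2.1 ξ.2.2.2.2) ξ.2.1| ≤ C₃ * |ξ.2.2.2.2 + l| ∧
    |deriv (fun t => G ξ.1 ξ.2.1 t ξ.2.2.2.1 ξ.2.2.2.2) ξ.2.2.1| ≤
      C₄ * (1 + |ξ.2.2.2.2| + |G ξ.1 ξ.2.1 ξ.2.2.1 ξ.2.2.2.1 ξ.2.2.2.2|) ∧
    |deriv (fun py => G ξ.1 ξ.2.1 ξ.2.2.1 ξ.2.2.2.1 py) ξ.2.2.2.2| ≤ C₅)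

/-- λ is an ergodic constant : bounded usc subsolution and bounded lsc
supersolution of `w_t + G = λ` exist. -/
def ErgodicConst {n : ℕ} (G : Ham n) (lam : ℝ) : Prop :=
  (∃ u, Bdd u ∧ ViscSub G 0 lam u) ∧ (∃ v, Bdd v ∧ ViscSuper G 0 lam v)

/-- λ solves the cell problem at (p_x,p_y) : the equation
`v_t + F(x,y,t,p_x + D_x v, p_y + D_y v) = λ` has a bounded space-time periodic
usc subsolution and a bounded space-time periodic lsc supersolution. -/
def CellOk {n : ℕ} (F : Ham n) (px : Euc n) (py lam : ℝ) : Prop :=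
  (∃ u, Bdd u ∧ STPeriodic u ∧
    ViscSub (fun x y t qx qy => F x y t (px + qx) (py + qy)) 0 lam u) ∧
  (∃ v, Bdd v ∧ STPeriodic v ∧
    ViscSuper (fun x y t qx qy => F x y t (px + qx) (py + qy)) 0 lam v)

/-- Viscosity subsolution of `w_t + G(x,y,t,D_x w,D_y w) = 0` on ℝⁿ×ℝ×(0,∞). -/
def ViscSubPos {n : ℕ} (G : Ham n) (u : Dom n → ℝ) : Prop :=
  ∀ φ : Dom n → ℝ, ContDiff ℝ 1 φ → ∀ z : Dom n, 0 < z.2.2 →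
    IsLocalMax (fun w => u w - φ w) z →
    pdT φ z + G z.1 z.2.1 z.2.2 (pdX φ z) (pdY φ z) ≤ 0

/-- Viscosity supersolution of `w_t + G(x,y,t,D_x w,D_y w) = 0` on ℝⁿ×ℝ×(0,∞). -/
def ViscSuperPos {n : ℕ} (G : Ham n) (u : Dom n → ℝ) : Prop :=
  ∀ φ : Dom n → ℝ, ContDiff ℝ 1 φ → ∀ z : Dom n, 0 < z.2.2 →
    IsLocalMin (fun w => u w - φ w) z →
    0 ≤ pdT φ z + G z.1 z.2.1 z.2.2 (pdX φ z) (pdY φ z)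

/-- Bounded uniformly continuous (on every slab ℝⁿ×ℝ×[0,T]) viscosity solution of the
initial value problem `v_t + G(x,y,t,D_x v,D_y v) = 0` on ℝⁿ×ℝ×(0,∞), `v(x,y,0) = v₀(x,y)`. -/
def IVPSol {n : ℕ} (G : Ham n) (v₀ : Dom2 n → ℝ) (v : Dom n → ℝ) : Prop :=
  ContinuousOn v {z : Dom n | 0 ≤ z.2.2} ∧
  (∀ x y, v (x, y, 0) = v₀ (x, y)) ∧
  ViscSubPos G v ∧ ViscSuperPos G v ∧
  (∀ T : ℝ, 0 < T →
    (∃ M, ∀ z : Dom n, 0 ≤ z.2.2 → z.2.2 ≤ T → |v z| ≤ M) ∧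
    UniformContinuousOn v {z : Dom n | 0 ≤ z.2.2 ∧ z.2.2 ≤ T})

/-- Viscosity subsolution of the eikonal-type inequality `w_t + c|D_x w| - C ≤ 0` on ℝⁿ×ℝ. -/
def ViscSubEik {n : ℕ} (c C : ℝ) (u : Dom2 n → ℝ) : Prop :=
  UpperSemicontinuous u ∧
  ∀ φ : Dom2 n → ℝ, ContDiff ℝ 1 φ → ∀ z : Dom2 n,
    IsLocalMax (fun w => u w - φ w) z →
    pdT2 φ z + c * ‖pdX2 φ z‖ - C ≤ 0


/-- A locally Lipschitz function with a.e. bounded derivative is Lipschitz between `a` and `b`. -/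
lemma lip_of_ae_deriv {f : ℝ → ℝ} (hf : LocallyLipschitz f) {a b C : ℝ}
    (h : ∀ᵐ x, x ∈ Set.uIcc a b → |deriv f x| ≤ C) : |f b - f a| ≤ C * |b - a| := by
  obtain ⟨K, hK⟩ := LocallyLipschitzOn.exists_lipschitzOnWith_of_compact
    (isCompact_uIcc (a := a) (b := b)) (hf.locallyLipschitzOn)
  have hac := hK.absolutelyContinuousOnInterval
  rw [← hac.integral_deriv_eq_sub]
  refine intervalIntegral.norm_integral_le_of_norm_le_const_ae (E := ℝ) ?_
  filter_upwards [h] with x hx hx'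
  exact hx (Set.uIoc_subset_uIcc hx')

lemma lip_of_ae_deriv_growth {f : ℝ → ℝ} (hf : LocallyLipschitz f) {a b C A : ℝ}
    (hC : 0 ≤ C) (hA : 0 ≤ A) (hab : 2 * C * |b - a| ≤ 1)
    (h : ∀ᵐ x, |deriv f x| ≤ C * (A + |f x|)) :
    |f b - f a| ≤ 2 * C * |b - a| * (A + |f a|) := by
  obtain ⟨c, hc, hmax⟩ := (isCompact_uIcc (a := a) (b := b)).exists_isMaxOn
    ⟨a, Set.left_mem_uIcc⟩ (f := fun r => |f r - f a|)
    ((hf.continuous.sub continuous_const).abs.continuousOn)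
  have hmax' : ∀ r ∈ Set.uIcc a b, |f r - f a| ≤ |f c - f a| := fun r hr => hmax hr
  have key : |f b - f a| ≤ |f c - f a| := hmax' b Set.right_mem_uIcc
  have hca : |c - a| ≤ |b - a| := Set.abs_sub_left_of_mem_uIcc hc
  have h1 : |f c - f a| ≤ C * (A + (|f a| + |f c - f a|)) * |c - a| := by
    refine lip_of_ae_deriv hf ?_
    filter_upwards [h] with x hx hx'
    refine hx.trans ?_
    have hxab : x ∈ Set.uIcc a b := Set.uIcc_subset_uIcc_left hc hx'
    have := hmax' x hxab
    have h2 : |f x| ≤ |f a| + |f x - f a| := by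
      have := abs_add_le (f a) (f x - f a)
      simpa using this
    gcongr
    linarith
  have h0 : 0 ≤ |f c - f a| := abs_nonneg _
  have h0' : 0 ≤ |f a| := abs_nonneg _
  have h3 : |f c - f a| ≤ C * (A + (|f a| + |f c - f a|)) * |b - a| :=
    h1.trans (by gcongr)
  nlinarith

/-- The Hamiltonian as a function on `Xi n`. -/
def unc {n : ℕ} (F : Ham n) (ξ : Xi n) : ℝ := F ξ.1 ξ.2.1 ξ.2.2.1 ξ.2.2.2.1 ξ.2.2.2.2

lemma dense_line {n : ℕ} {p : Xi n → Prop} (hp : ∀ᵐ ξ ∂(volume : Measure (Xi n)), p ξ)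
    (e : Xi n) : Dense {ξ : Xi n | ∀ᵐ s : ℝ, p (ξ + s • e)} := by
  let N : Set (Xi n) := toMeasurable volume {ξ | ¬ p ξ}
  have hN : MeasurableSet N := measurableSet_toMeasurable _ _
  have hN0 : volume N = 0 := by
    rw [measure_toMeasurable]; exact hp
  have h1 : ∀ᵐ ξ ∂(volume : Measure (Xi n)), ξ ∈ Nᶜ := by
    rw [ae_iff]; simpa using hN0
  have i1 : (volume : Measure (Euc n × ℝ)).IsAddHaarMeasure :=
    Measure.prod.instIsAddHaarMeasure volume volume
  have i2 : (volume : Measure (ℝ × Euc n × ℝ)).IsAddHaarMeasure :=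
    Measure.prod.instIsAddHaarMeasure volume volume
  have i3 : (volume : Measure (ℝ × ℝ × Euc n × ℝ)).IsAddHaarMeasure :=
    Measure.prod.instIsAddHaarMeasure volume volume
  have i4 : (volume : Measure (Xi n)).IsAddHaarMeasure :=
    Measure.prod.instIsAddHaarMeasure volume volume
  have h2 := (ae_ae_add_linearMap_mem_iff (LinearMap.toSpanSingleton ℝ (Xi n) e)
    (volume : Measure ℝ) (volume : Measure (Xi n)) hN.compl).2 h1
  refine Measure.dense_of_ae (μ := volume) ?_
  filter_upwards [h2] with ξ hξ
  filter_upwards [hξ] with s hs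
  by_contra hc
  exact hs (subset_toMeasurable _ _ hc)

lemma forall_of_dense {X : Type*} [TopologicalSpace X] {S T : Set X} (hS : Dense S)
    (hT : IsClosed T) (h : S ⊆ T) (ξ : X) : ξ ∈ T := hT.closure_subset_iff.2 h (hS ξ)

section H3
variable {n : ℕ} {F : Ham n} {C₃ C₄ C₅ : ℝ}

lemma h3_y (h1 : HypH1 F) (h3 : HypH3 F 0 C₃ C₄ C₅) (x : Euc n) (y y' t : ℝ) (P : Euc n) (Q : ℝ) :
    |F x y t P Q - F x y' t P Q| ≤ C₃ * |Q| * |y - y'| := by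
  obtain ⟨-, -, -, hl, hae⟩ := h3
  have hcont : Continuous (unc F) := h1.1
  have hd := dense_line hae ((0, 1, 0, 0, 0) : Xi n)
  set h := y - y' with hh
  have hcl : IsClosed {ξ : Xi n | |unc F (ξ + h • ((0, 1, 0, 0, 0) : Xi n)) - unc F ξ|
      ≤ C₃ * |ξ.2.2.2.2| * |h|} := by
    refine isClosed_le ?_ ?_
    · exact ((hcont.comp (by fun_prop)).sub hcont).abs
    · fun_prop
  have hall := forall_of_dense hd hcl ?_
  · have := hall (x, y', t, P, Q)
    simp [unc, hh] at this
    exact this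
  · intro ξ hξ'
    simp only [Set.mem_ofPred_eq] at hξ' ⊢
    simp only [unc, Prod.fst_add, Prod.snd_add, Prod.smul_fst, Prod.smul_snd, smul_zero, add_zero,
      smul_eq_mul, mul_one] at hξ' ⊢
    let f : ℝ → ℝ := fun s => F ξ.1 (ξ.2.1 + s) ξ.2.2.1 ξ.2.2.2.1 ξ.2.2.2.2
    have hf : LocallyLipschitz f := (hl ξ.1 ξ.2.2.2.1).comp
      (g := fun s : ℝ => ((ξ.2.1 + s, ξ.2.2.1, ξ.2.2.2.2) : ℝ × ℝ × ℝ))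
      (ContDiff.locallyLipschitz (𝕂 := ℝ) (by fun_prop))
    have := lip_of_ae_deriv hf (a := 0) (b := h) (C := C₃ * |ξ.2.2.2.2|) (by
      filter_upwards [hξ'] with s hs _
      have e : deriv f s = deriv (fun y => F ξ.1 y ξ.2.2.1 ξ.2.2.2.1 ξ.2.2.2.2) (ξ.2.1 + s) :=
        deriv_comp_const_add (fun y => F ξ.1 y ξ.2.2.1 ξ.2.2.2.1 ξ.2.2.2.2) ξ.2.1 s
      rw [e]
      simpa using hs.1)
    simpa [f] using this

lemma h3_q (h1 : HypH1 F) (h3 : HypH3 F 0 C₃ C₄ C₅) (x : Euc n) (y t : ℝ) (P : Euc n) (Q Q' : ℝ) :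
    |F x y t P Q - F x y t P Q'| ≤ C₅ * |Q - Q'| := by
  obtain ⟨-, -, -, hl, hae⟩ := h3
  have hcont : Continuous (unc F) := h1.1
  have hd := dense_line hae ((0, 0, 0, 0, 1) : Xi n)
  set h := Q - Q' with hh
  have hcl : IsClosed {ξ : Xi n | |unc F (ξ + h • ((0, 0, 0, 0, 1) : Xi n)) - unc F ξ|
      ≤ C₅ * |h|} := by
    refine isClosed_le ?_ ?_
    · exact ((hcont.comp (by fun_prop)).sub hcont).abs
    · fun_prop
  have hall := forall_of_dense hd hcl ?_
  · have := hall (x, y, t, P, Q')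
    simp [unc, hh] at this
    exact this
  · intro ξ hξ'
    simp only [Set.mem_ofPred_eq] at hξ' ⊢
    simp only [unc, Prod.fst_add, Prod.snd_add, Prod.smul_fst, Prod.smul_snd, smul_zero, add_zero,
      smul_eq_mul, mul_one] at hξ' ⊢
    let f : ℝ → ℝ := fun s => F ξ.1 ξ.2.1 ξ.2.2.1 ξ.2.2.2.1 (ξ.2.2.2.2 + s)
    have hf : LocallyLipschitz f := (hl ξ.1 ξ.2.2.2.1).comp
      (g := fun s : ℝ => ((ξ.2.1, ξ.2.2.1, ξ.2.2.2.2 + s) : ℝ × ℝ × ℝ))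
      (ContDiff.locallyLipschitz (𝕂 := ℝ) (by fun_prop))
    have := lip_of_ae_deriv hf (a := 0) (b := h) (C := C₅) (by
      filter_upwards [hξ'] with s hs _
      have e : deriv f s = deriv (fun q => F ξ.1 ξ.2.1 ξ.2.2.1 ξ.2.2.2.1 q) (ξ.2.2.2.2 + s) :=
        deriv_comp_const_add (fun q => F ξ.1 ξ.2.1 ξ.2.2.1 ξ.2.2.2.1 q) ξ.2.2.2.2 s
      rw [e]
      simpa using hs.2.2)
    simpa [f] using this

lemma h3_t (h1 : HypH1 F) (h3 : HypH3 F 0 C₃ C₄ C₅) (x : Euc n) (y t s : ℝ) (P : Euc n) (Q : ℝ)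
    (hts : 2 * C₄ * |t - s| ≤ 1) :
    |F x y t P Q - F x y s P Q| ≤ 2 * C₄ * |t - s| * (1 + |Q| + |F x y s P Q|) := by
  obtain ⟨-, hC4, -, hl, hae⟩ := h3
  have hcont : Continuous (unc F) := h1.1
  have hd := dense_line hae ((0, 0, 1, 0, 0) : Xi n)
  set h := t - s with hh
  have hcl : IsClosed {ξ : Xi n | |unc F (ξ + h • ((0, 0, 1, 0, 0) : Xi n)) - unc F ξ|
      ≤ 2 * C₄ * |h| * (1 + |ξ.2.2.2.2| + |unc F ξ|)} := by
    refine isClosed_le ?_ ?_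
    · exact ((hcont.comp (by fun_prop)).sub hcont).abs
    · fun_prop
  have hall := forall_of_dense hd hcl ?_
  · have := hall (x, y, s, P, Q)
    simp [unc, hh] at this
    exact this
  · intro ξ hξ'
    simp only [Set.mem_ofPred_eq] at hξ' ⊢
    simp only [unc, Prod.fst_add, Prod.snd_add, Prod.smul_fst, Prod.smul_snd, smul_zero, add_zero,
      smul_eq_mul, mul_one] at hξ' ⊢
    let f : ℝ → ℝ := fun s => F ξ.1 ξ.2.1 (ξ.2.2.1 + s) ξ.2.2.2.1 ξ.2.2.2.2
    have hf : LocallyLipschitz f := (hl ξ.1 ξ.2.2.2.1).comp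
      (g := fun s : ℝ => ((ξ.2.1, ξ.2.2.1 + s, ξ.2.2.2.2) : ℝ × ℝ × ℝ))
      (ContDiff.locallyLipschitz (𝕂 := ℝ) (by fun_prop))
    have := lip_of_ae_deriv_growth hf (a := 0) (b := h) (C := C₄) (A := 1 + |ξ.2.2.2.2|)
      hC4 (by positivity) (by simpa using hts) (by
      filter_upwards [hξ'] with s hs
      have e : deriv f s = deriv (fun t => F ξ.1 ξ.2.1 t ξ.2.2.2.1 ξ.2.2.2.2) (ξ.2.2.1 + s) :=
        deriv_comp_const_add (fun t => F ξ.1 ξ.2.1 t ξ.2.2.2.1 ξ.2.2.2.2) ξ.2.2.1 s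
      rw [e]
      simpa using hs.2.1)
    simpa [f] using this

end H3

/-- The `(y,t)` part of the penalization. -/
def penE {n : ℕ} (K δ : ℝ) (z z' : Dom n) : ℝ :=
  Real.exp (K * z.2.2) * ((z.2.1 - z'.2.1) ^ 2 + (z.2.2 - z'.2.2) ^ 2) / δ

def penX {n : ℕ} (η : ℝ) (z z' : Dom n) : ℝ := ‖z.1 - z'.1‖ ^ 2 / η

def psi (ε : ℝ) (J : ℕ) (t : ℝ) : ℝ := ε * t - ε * t ^ 2 / (2 * J)

/-- The linear form with gradient `(ξ, q, τ)`. -/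
def gradL {n : ℕ} (ξ : Euc n) (q τ : ℝ) : Dom n →L[ℝ] ℝ :=
  (innerSL ℝ ξ).comp (ContinuousLinearMap.fst ℝ (Euc n) (ℝ × ℝ)) +
  q • (ContinuousLinearMap.fst ℝ ℝ ℝ).comp (ContinuousLinearMap.snd ℝ (Euc n) (ℝ × ℝ)) +
  τ • (ContinuousLinearMap.snd ℝ ℝ ℝ).comp (ContinuousLinearMap.snd ℝ (Euc n) (ℝ × ℝ))

lemma gradL_apply {n : ℕ} (ξ : Euc n) (q τ : ℝ) (w : Dom n) :
    gradL ξ q τ w = ⟪ξ, w.1⟫ + q * w.2.1 + τ * w.2.2 := by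
  simp [gradL]

lemma pd_of_hasFDerivAt {n : ℕ} {φ : Dom n → ℝ} {z : Dom n} {ξ : Euc n} {q τ : ℝ}
    (h : HasFDerivAt φ (gradL ξ q τ) z) : pdX φ z = ξ ∧ pdY φ z = q ∧ pdT φ z = τ := by
  unfold pdX pdY pdT
  rw [h.fderiv]
  refine ⟨?_, ?_, ?_⟩
  · ext i
    simp [gradL_apply, EuclideanSpace.inner_single_right]
  · simp [gradL_apply]
  · simp [gradL_apply]

lemma hasFDerivAt_float {n : ℕ} (K δ η : ℝ) (z z' : Dom n) :
    HasFDerivAt (fun w => penE K δ z w + penX η z w)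
      (gradL ((2 / η) • (z'.1 - z.1)) (2 * Real.exp (K * z.2.2) * (z'.2.1 - z.2.1) / δ)
        (2 * Real.exp (K * z.2.2) * (z'.2.2 - z.2.2) / δ)) z' := by
  have hx : HasFDerivAt (fun w : Dom n => w.1) (ContinuousLinearMap.fst ℝ (Euc n) (ℝ × ℝ)) z' :=
    hasFDerivAt_fst
  have hyt : HasFDerivAt (fun w : Dom n => w.2) (ContinuousLinearMap.snd ℝ (Euc n) (ℝ × ℝ)) z' :=
    hasFDerivAt_snd
  have hy := hyt.fst
  have ht := hyt.snd
  have h1 := ((((hy.const_sub z.2.1).pow 2).add ((ht.const_sub z.2.2).pow 2)).const_mul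
    (Real.exp (K * z.2.2))).mul_const δ⁻¹
  have h2 := ((hx.const_sub z.1).norm_sq).mul_const η⁻¹
  refine (h1.add h2).congr_fderiv ?_
  ext w
  · simp [gradL_apply, inner_sub_left, inner_smul_left]
    ring
  · simp [gradL_apply]
    ring
  · simp [gradL_apply]
    ring

lemma hasFDerivAt_anchor {n : ℕ} (K δ η ε : ℝ) (J : ℕ) (z z' : Dom n) :
    HasFDerivAt (fun w : Dom n => penE K δ w z' + penX η w z' - psi ε J w.2.2)
      (gradL (-((2 / η) • (z'.1 - z.1))) (-(2 * Real.exp (K * z.2.2) * (z'.2.1 - z.2.1) / δ))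
        (-(2 * Real.exp (K * z.2.2) * (z'.2.2 - z.2.2) / δ) + K * penE K δ z z'
          - (ε - ε * z.2.2 / J))) z := by
  have hx : HasFDerivAt (fun w : Dom n => w.1) (ContinuousLinearMap.fst ℝ (Euc n) (ℝ × ℝ)) z :=
    hasFDerivAt_fst
  have hyt : HasFDerivAt (fun w : Dom n => w.2) (ContinuousLinearMap.snd ℝ (Euc n) (ℝ × ℝ)) z :=
    hasFDerivAt_snd
  have hy := hyt.fst
  have ht := hyt.snd
  have h1 := (((ht.const_mul K).exp).mul
    ((((hy.sub_const z'.2.1).pow 2).add ((ht.sub_const z'.2.2).pow 2)))).mul_const δ⁻¹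
  have h2 := ((hx.sub_const z'.1).norm_sq).mul_const η⁻¹
  have h3 := (ht.const_mul ε).sub (((ht.pow 2).const_mul ε).mul_const (2 * (J : ℝ))⁻¹)
  refine ((h1.add h2).sub h3).congr_fderiv ?_
  ext w
  · simp [gradL_apply, inner_sub_left, inner_smul_left]
    ring
  · simp [gradL_apply]
    ring
  · simp [gradL_apply, penE]
    ring

lemma contDiff_float {n : ℕ} (K δ η : ℝ) (z : Dom n) :
    ContDiff ℝ 1 (fun w => penE K δ z w + penX η z w) := by
  unfold penE penX
  refine ContDiff.add ?_ ?_
  · fun_prop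
  · exact (ContDiff.norm_sq ℝ (by fun_prop)).div_const _

lemma contDiff_anchor {n : ℕ} (K δ η ε : ℝ) (J : ℕ) (z' : Dom n) :
    ContDiff ℝ 1 (fun w : Dom n => penE K δ w z' + penX η w z' - psi ε J w.2.2) := by
  unfold penE penX psi
  refine ContDiff.sub (ContDiff.add ?_ ?_) ?_
  · fun_prop
  · exact (ContDiff.norm_sq ℝ (by fun_prop)).div_const _
  · fun_prop

lemma STPeriodic.y_int {n : ℕ} {u : Dom n → ℝ} (h : STPeriodic u) (m : ℤ) (x : Euc n) (y t : ℝ) :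
    u (x, y + m, t) = u (x, y, t) := by
  have hp : Function.Periodic (fun y => u (x, y, t)) 1 := fun y => h.2.1 x y t
  simpa using hp.int_mul m y

lemma STPeriodic.t_int {n : ℕ} {u : Dom n → ℝ} (h : STPeriodic u) (m : ℤ) (x : Euc n) (y t : ℝ) :
    u (x, y, t + m) = u (x, y, t) := by
  have hp : Function.Periodic (fun t => u (x, y, t)) 1 := fun t => h.2.2 x y t
  simpa using hp.int_mul m t

lemma exists_shift {n : ℕ} (x : Euc n) : ∃ k : Fin n → ℤ, ‖x + intVec k‖ ≤ n := by
  refine ⟨fun i => -⌊x i⌋, ?_⟩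
  rw [EuclideanSpace.norm_eq]
  refine Real.sqrt_le_iff.2 ⟨by positivity, ?_⟩
  have h1 : ∀ i ∈ (Finset.univ : Finset (Fin n)),
      ‖(x + intVec (fun i => -⌊x i⌋)) i‖ ^ 2 ≤ (1 : ℝ) := by
    intro i _
    have e : (x + intVec (fun i => -⌊x i⌋)) i = Int.fract (x i) := by
      simp [intVec, Int.fract, sub_eq_add_neg]
    rw [e, Real.norm_eq_abs, abs_of_nonneg (Int.fract_nonneg _)]
    have := Int.fract_nonneg (x i)
    have := Int.fract_lt_one (x i)
    nlinarith
  have h2 := Finset.sum_le_sum h1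
  simp only [Finset.sum_const, Finset.card_univ, Fintype.card_fin, nsmul_eq_mul, mul_one] at h2
  refine h2.trans ?_
  rcases Nat.eq_zero_or_pos n with h | h
  · simp [h]
  · have : (1 : ℝ) ≤ n := by exact_mod_cast h
    nlinarith

lemma exists_max {n : ℕ} {w : Dom n → Dom n → ℝ}
    (hw : UpperSemicontinuous (fun a : Dom n × Dom n => w a.1 a.2))
    (hp1 : ∀ z', STPeriodic (fun z => w z z')) (hp2 : ∀ z, STPeriodic (w z))
    {M ε K δ η : ℝ} {J : ℕ} (hM : 0 < M) (hε : 0 < ε) (hK : 0 ≤ K) (hδ : 0 < δ) (hδ1 : δ ≤ 1)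
    (hη : 0 < η) (hη1 : η ≤ 1) (hJ : 0 < J) (hJM : 6 * M ≤ ε * J)
    (hosc : ∀ z z' z'', w z z' ≤ w z z'' + 2 * M) :
    ∃ z z' : Dom n, 0 < z.2.2 ∧ z.2.2 < 2 * J ∧ ‖z.1‖ ≤ n ∧ 0 ≤ z.2.1 ∧ z.2.1 ≤ 1 ∧
      penE K δ z z' + penX η z z' ≤ 2 * M ∧
      ∀ a b : Dom n, 0 ≤ a.2.2 → a.2.2 ≤ 2 * J →
        w a b + psi ε J a.2.2 - (penE K δ a b + penX η a b) ≤
        w z z' + psi ε J z.2.2 - (penE K δ z z' + penX η z z') := by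
  have hJ' : (0 : ℝ) < J := by exact_mod_cast hJ
  have pE0 : ∀ a b : Dom n, 0 ≤ penE K δ a b := fun a b => by unfold penE; positivity
  have pX0 : ∀ a b : Dom n, 0 ≤ penX η a b := fun a b => by unfold penX; positivity
  have pE_self : ∀ a : Dom n, penE K δ a a = 0 := fun a => by simp [penE]
  have pX_self : ∀ a : Dom n, penX η a a = 0 := fun a => by simp [penX]
  let A : Set (Dom n) := Metric.closedBall 0 n ×ˢ (Set.Icc 0 1 ×ˢ Set.Icc 0 (2 * (J : ℝ)))
  let B : Set (Dom n) := Metric.closedBall 0 (n + 1 + 2 * J + (2 * M + 1))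
  have hAmem : ∀ (x : Euc n) (y t : ℝ), ‖x‖ ≤ n → 0 ≤ y → y ≤ 1 → 0 ≤ t → t ≤ 2 * J →
      (x, y, t) ∈ A := fun x y t hx h0 h1 h2 h3 =>
    ⟨mem_closedBall_zero_iff.2 hx, ⟨h0, h1⟩, h2, h3⟩
  have hA : IsCompact A := (isCompact_closedBall _ _).prod (isCompact_Icc.prod isCompact_Icc)
  have hB : IsCompact B := isCompact_closedBall _ _
  have hAnorm : ∀ a ∈ A, ‖a‖ ≤ n + 1 + 2 * J := by
    rintro ⟨x, y, t⟩ ⟨hx, ⟨hy0, hy1⟩, ht0, ht1⟩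
    simp only [Metric.mem_closedBall, dist_zero_right] at *
    have hn : (0 : ℝ) ≤ n := by positivity
    simp only [Prod.norm_mk, sup_le_iff, Real.norm_eq_abs]
    refine ⟨by linarith, ?_, ?_⟩
    · rw [abs_of_nonneg hy0]; linarith
    · rw [abs_of_nonneg ht0]; linarith
  let Φ : Dom n × Dom n → ℝ := fun a =>
    w a.1 a.2 + (psi ε J a.1.2.2 - (penE K δ a.1 a.2 + penX η a.1 a.2))
  have hΦ : UpperSemicontinuous Φ := by
    refine hw.add (Continuous.upperSemicontinuous ?_)
    unfold psi penE penX
    fun_prop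
  have h0A : (0 : Dom n) ∈ A := by
    simp [A, Prod.zero_eq_mk]
  have hAB : ∀ a ∈ A, a ∈ B := fun a ha => by
    have := hAnorm a ha
    simp only [B, Metric.mem_closedBall, dist_zero_right]; linarith
  obtain ⟨⟨z, z'⟩, ⟨hz, hz'⟩, hmax⟩ := UpperSemicontinuousOn.exists_isMaxOn
    (s := A ×ˢ B) ⟨(0, 0), h0A, hAB 0 h0A⟩ (hA.prod hB) (hΦ.upperSemicontinuousOn _)
  have hmax' : ∀ a ∈ A, ∀ b ∈ B, Φ (a, b) ≤ Φ (z, z') := fun a ha b hb =>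
    hmax (show (a, b) ∈ A ×ˢ B from ⟨ha, hb⟩)
  have hself : ∀ a, Φ (a, a) = w a a + psi ε J a.2.2 := fun a => by
    simp [Φ, pE_self, pX_self]
  -- anchors in A
  have hAall : ∀ a ∈ A, ∀ b, Φ (a, b) ≤ Φ (z, z') := by
    intro a ha b
    by_cases hb : penE K δ a b + penX η a b ≤ 2 * M
    · refine hmax' a ha b ?_
      have hd : ‖b - a‖ ≤ 2 * M + 1 := by
        have ha2 := ha
        obtain ⟨x, y, t⟩ := a
        obtain ⟨x', y', t'⟩ := b
        obtain ⟨-, -, ht0, -⟩ := ha2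
        have e1 := pE0 (x, y, t) (x', y', t')
        have e2 := pX0 (x, y, t) (x', y', t')
        have f1 : penE K δ (x, y, t) (x', y', t') ≤ 2 * M := by linarith
        have f2 : penX η (x, y, t) (x', y', t') ≤ 2 * M := by linarith
        simp only [penE, penX] at f1 f2 ht0
        have hexp : 1 ≤ Real.exp (K * t) := Real.one_le_exp (mul_nonneg hK ht0)
        rw [div_le_iff₀ hδ] at f1
        rw [div_le_iff₀ hη] at f2
        have f3 : (y - y') ^ 2 + (t - t') ^ 2 ≤ 2 * M := by
          have : 0 ≤ (y - y') ^ 2 + (t - t') ^ 2 := by positivity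
          nlinarith
        have f4 : ‖x - x'‖ ^ 2 ≤ 2 * M := by nlinarith
        simp only [Prod.mk_sub_mk, Prod.norm_mk, sup_le_iff, Real.norm_eq_abs]
        refine ⟨?_, ?_, ?_⟩
        · rw [norm_sub_rev]; nlinarith [norm_nonneg (x - x')]
        · rw [abs_le]; constructor <;> nlinarith [sq_nonneg (t - t')]
        · rw [abs_le]; constructor <;> nlinarith [sq_nonneg (y - y')]
      have := hAnorm a ha
      simp only [B, Metric.mem_closedBall, dist_zero_right]
      have h5 : ‖b‖ ≤ ‖a‖ + ‖b - a‖ := by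
        have := norm_add_le a (b - a)
        simpa using this
      linarith
    · refine le_trans ?_ (hmax' a ha a (hAB a ha))
      rw [hself]
      have := hosc a b a
      simp only [Φ]
      linarith
  have hall : ∀ a b : Dom n, 0 ≤ a.2.2 → a.2.2 ≤ 2 * J → Φ (a, b) ≤ Φ (z, z') := by
    rintro ⟨x, y, t⟩ ⟨x', y', t'⟩ h0 h1
    obtain ⟨k, hk⟩ := exists_shift x
    have e : Φ ((x, y, t), (x', y', t')) =
        Φ ((x + intVec k, y + ((-⌊y⌋ : ℤ) : ℝ), t),
          (x' + intVec k, y' + ((-⌊y⌋ : ℤ) : ℝ), t')) := by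
      have e1 : w (x, y, t) (x', y', t') =
        w (x + intVec k, y + ((-⌊y⌋ : ℤ) : ℝ), t) (x' + intVec k, y' + ((-⌊y⌋ : ℤ) : ℝ), t') := by
        rw [(hp2 _).y_int, (hp2 _).1]
        have e2 := (hp1 (x', y', t')).y_int (-⌊y⌋) (x + intVec k) y t
        have e3 := (hp1 (x', y', t')).1 k x y t
        simp only at e2 e3
        rw [e2, e3]
      simp only [Φ, penE, penX, e1, add_sub_add_right_eq_sub]
    rw [e]
    refine hAall _ (hAmem _ _ _ hk ?_ ?_ h0 h1) _
    · have := Int.floor_le y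
      push_cast; linarith
    · have := (Int.lt_floor_add_one y).le
      push_cast; linarith
  have hpen : penE K δ z z' + penX η z z' ≤ 2 * M := by
    have h1 := hmax' z hz z (hAB z hz)
    rw [hself] at h1
    have := hosc z z' z
    simp only [Φ] at h1
    linarith
  obtain ⟨hzx, ⟨hy0, hy1⟩, ht0, ht1⟩ := hz
  -- endpoints are excluded
  have hend : ∀ m : ℤ, z.2.2 + m = J → psi ε J z.2.2 = 0 → False := by
    intro m hm hpsi
    let c : Dom n := (z.1, z.2.1, (J : ℝ))
    have h1 := hall c c (by simp [c]) (by simp only [c]; linarith)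
    rw [hself] at h1
    have h2 : w c c = w z c := by
      have := (hp1 c).t_int m z.1 z.2.1 z.2.2
      rw [hm] at this
      exact this
    have h3 : psi ε J c.2.2 = ε * J / 2 := by
      simp only [psi, c]; field_simp; ring
    have h4 := hosc z z' c
    have h5 := pE0 z z'
    have h6 := pX0 z z'
    simp only [Φ] at h1
    linarith
  refine ⟨z, z', lt_of_le_of_ne ht0 ?_, lt_of_le_of_ne ht1 ?_, by simpa using hzx, hy0, hy1, hpen, ?_⟩
  · intro h
    exact hend J (by rw [← h]; simp) (by rw [← h]; simp [psi])
  · intro h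
    refine hend (-J) (by rw [h]; push_cast; ring) ?_
    rw [h]
    simp only [psi]; field_simp; ring
  · intro a b ha hb
    have := hall a b ha hb
    simp only [Φ] at this
    linarith

lemma neg_gradL {n : ℕ} (ξ : Euc n) (q τ : ℝ) : -gradL ξ q τ = gradL (-ξ) (-q) (-τ) := by
  refine ContinuousLinearMap.ext fun w => ?_
  rw [neg_apply, gradL_apply, gradL_apply]
  simp only [inner_neg_left]
  ring

lemma usc_diff {n : ℕ} {u v : Dom n → ℝ} (hu : UpperSemicontinuous u)
    (hv : LowerSemicontinuous v) :
    UpperSemicontinuous (fun a : Dom n × Dom n => u a.1 - v a.2) := by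
  have h1 : UpperSemicontinuous (fun a : Dom n × Dom n => u a.1) := hu.comp continuous_fst
  have h2 : UpperSemicontinuous (fun a : Dom n × Dom n => -v a.2) := by
    intro a c hc
    have := (hv.comp (continuous_snd (X := Dom n))) a (-c) (by simp only [Function.comp_apply] at hc ⊢; linarith)
    filter_upwards [this] with b hb
    simp only [Function.comp_apply] at hb; linarith
  simpa [sub_eq_add_neg] using h1.add h2

lemma STPeriodic.const_sub {n : ℕ} {u : Dom n → ℝ} (h : STPeriodic u) (c : ℝ) :
    STPeriodic (fun z => c - u z) :=
  ⟨fun k x y t => by simp only [h.1], fun x y t => by simp only [h.2.1],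
    fun x y t => by simp only [h.2.2]⟩

lemma STPeriodic.sub_const {n : ℕ} {u : Dom n → ℝ} (h : STPeriodic u) (c : ℝ) :
    STPeriodic (fun z => u z - c) :=
  ⟨fun k x y t => by simp only [h.1], fun x y t => by simp only [h.2.1],
    fun x y t => by simp only [h.2.2]⟩

/-- Doubling of variables: the subsolution floats. -/
lemma doubling_sub {n : ℕ} {A B : Ham n} {lam mu : ℝ} {u v : Dom n → ℝ}
    (hu : ViscSub A 0 lam u) (hv : ViscSuper B 0 mu v) (hup : STPeriodic u) (hvp : STPeriodic v)
    {M ε K δ η : ℝ} {J : ℕ} (hM : 0 < M) (hε : 0 < ε) (hK : 0 ≤ K) (hδ : 0 < δ) (hδ1 : δ ≤ 1)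
    (hη : 0 < η) (hη1 : η ≤ 1) (hJ : 0 < J) (hJM : 6 * M ≤ ε * J) (hub : ∀ z, |u z| ≤ M) :
    ∃ (z z' : Dom n) (ξ : Euc n) (q τ : ℝ), 0 < z.2.2 ∧ z.2.2 < 2 * J ∧ ‖z.1‖ ≤ n ∧
      0 ≤ z.2.1 ∧ z.2.1 ≤ 1 ∧ penE K δ z z' + penX η z z' ≤ 2 * M ∧
      |q| = 2 * Real.exp (K * z.2.2) * |z.2.1 - z'.2.1| / δ ∧
      |τ| = 2 * Real.exp (K * z.2.2) * |z.2.2 - z'.2.2| / δ ∧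
      τ + A z'.1 z'.2.1 z'.2.2 ξ q ≤ lam ∧
      mu ≤ ε - K * penE K δ z z' + τ + B z.1 z.2.1 z.2.2 ξ q := by
  obtain ⟨z, z', ht0, ht1, hx, hy0, hy1, hpen, hmax⟩ :=
    exists_max (w := fun z z' => u z' - v z)
      ((usc_diff hu.1 hv.1).comp (continuous_swap (X := Dom n) (Y := Dom n)))
      (fun z' => hvp.const_sub _) (fun z => hup.sub_const _) hM hε hK hδ hδ1 hη hη1 hJ hJM
      (fun z z' z'' => by
        have := abs_le.1 (hub z'); have := abs_le.1 (hub z''); linarith)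
  have hJ' : (0 : ℝ) < J := by exact_mod_cast hJ
  have hE := Real.exp_pos (K * z.2.2)
  refine ⟨z, z', (2 / η) • (z'.1 - z.1), 2 * Real.exp (K * z.2.2) * (z'.2.1 - z.2.1) / δ,
    2 * Real.exp (K * z.2.2) * (z'.2.2 - z.2.2) / δ, ht0, ht1, hx, hy0, hy1, hpen, ?_, ?_, ?_, ?_⟩
  · rw [abs_div, abs_mul, abs_of_pos hδ, abs_of_pos (by positivity : 0 < 2 * Real.exp (K * z.2.2)),
      abs_sub_comm]
  · rw [abs_div, abs_mul, abs_of_pos hδ, abs_of_pos (by positivity : 0 < 2 * Real.exp (K * z.2.2)),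
      abs_sub_comm]
  · have hd := pd_of_hasFDerivAt (hasFDerivAt_float K δ η z z')
    have := hu.2 _ (contDiff_float K δ η z) z' (Eventually.of_forall fun b => by
      have := hmax z b ht0.le ht1.le
      simp only at this ⊢; linarith)
    rw [hd.1, hd.2.1, hd.2.2] at this
    simpa using this
  · have hd0 := (hasFDerivAt_anchor K δ η ε J z z').fun_neg
    rw [neg_gradL] at hd0
    have hd := pd_of_hasFDerivAt hd0
    have hnear : ∀ᶠ a : Dom n in 𝓝 z, 0 < a.2.2 ∧ a.2.2 < 2 * J := by
      have hc : ContinuousAt (fun a : Dom n => a.2.2) z := by fun_prop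
      exact (hc.eventually (lt_mem_nhds ht0)).and (hc.eventually (gt_mem_nhds ht1))
    have := hv.2 _ (contDiff_anchor K δ η ε J z').neg z (by
      filter_upwards [hnear] with a ha
      have := hmax a z' ha.1.le ha.2.le
      linarith)
    rw [hd.1, hd.2.1, hd.2.2] at this
    simp only [neg_neg] at this
    have h7 : 0 ≤ ε * z.2.2 / J := by positivity
    linarith

/-- Doubling of variables: the supersolution floats. -/
lemma doubling_super {n : ℕ} {A B : Ham n} {lam mu : ℝ} {u v : Dom n → ℝ}
    (hv : ViscSuper A 0 lam v) (hu : ViscSub B 0 mu u) (hvp : STPeriodic v) (hup : STPeriodic u)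
    {M ε K δ η : ℝ} {J : ℕ} (hM : 0 < M) (hε : 0 < ε) (hK : 0 ≤ K) (hδ : 0 < δ) (hδ1 : δ ≤ 1)
    (hη : 0 < η) (hη1 : η ≤ 1) (hJ : 0 < J) (hJM : 6 * M ≤ ε * J) (hvb : ∀ z, |v z| ≤ M) :
    ∃ (z z' : Dom n) (ξ : Euc n) (q τ : ℝ), 0 < z.2.2 ∧ z.2.2 < 2 * J ∧ ‖z.1‖ ≤ n ∧
      0 ≤ z.2.1 ∧ z.2.1 ≤ 1 ∧ penE K δ z z' + penX η z z' ≤ 2 * M ∧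
      |q| = 2 * Real.exp (K * z.2.2) * |z.2.1 - z'.2.1| / δ ∧
      |τ| = 2 * Real.exp (K * z.2.2) * |z.2.2 - z'.2.2| / δ ∧
      -ε + K * penE K δ z z' + τ + B z.1 z.2.1 z.2.2 ξ q ≤ mu ∧
      lam ≤ τ + A z'.1 z'.2.1 z'.2.2 ξ q := by
  obtain ⟨z, z', ht0, ht1, hx, hy0, hy1, hpen, hmax⟩ :=
    exists_max (w := fun z z' => u z - v z') (usc_diff hu.1 hv.1)
      (fun z' => hup.sub_const _) (fun z => hvp.const_sub _) hM hε hK hδ hδ1 hη hη1 hJ hJM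
      (fun z z' z'' => by
        have := abs_le.1 (hvb z'); have := abs_le.1 (hvb z''); linarith)
  have hJ' : (0 : ℝ) < J := by exact_mod_cast hJ
  have hE := Real.exp_pos (K * z.2.2)
  refine ⟨z, z', -((2 / η) • (z'.1 - z.1)), -(2 * Real.exp (K * z.2.2) * (z'.2.1 - z.2.1) / δ),
    -(2 * Real.exp (K * z.2.2) * (z'.2.2 - z.2.2) / δ), ht0, ht1, hx, hy0, hy1, hpen, ?_, ?_, ?_, ?_⟩
  · rw [abs_neg, abs_div, abs_mul, abs_of_pos hδ,
      abs_of_pos (by positivity : 0 < 2 * Real.exp (K * z.2.2)), abs_sub_comm]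
  · rw [abs_neg, abs_div, abs_mul, abs_of_pos hδ,
      abs_of_pos (by positivity : 0 < 2 * Real.exp (K * z.2.2)), abs_sub_comm]
  · have hd := pd_of_hasFDerivAt (hasFDerivAt_anchor K δ η ε J z z')
    have hnear : ∀ᶠ a : Dom n in 𝓝 z, 0 < a.2.2 ∧ a.2.2 < 2 * J := by
      have hc : ContinuousAt (fun a : Dom n => a.2.2) z := by fun_prop
      exact (hc.eventually (lt_mem_nhds ht0)).and (hc.eventually (gt_mem_nhds ht1))
    have := hu.2 _ (contDiff_anchor K δ η ε J z') z (by
      filter_upwards [hnear] with a ha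
      have := hmax a z' ha.1.le ha.2.le
      linarith)
    rw [hd.1, hd.2.1, hd.2.2] at this
    have h7 : 0 ≤ ε * z.2.2 / J := by positivity
    linarith
  · have hd0 := (hasFDerivAt_float K δ η z z').fun_neg
    rw [neg_gradL] at hd0
    have hd := pd_of_hasFDerivAt hd0
    have := hv.2 _ (contDiff_float K δ η z).neg z' (Eventually.of_forall fun b => by
      have := hmax z b ht0.le ht1.le
      simp only at this ⊢; linarith)
    rw [hd.1, hd.2.1, hd.2.2] at this
    simpa using this

lemma ham_est {n : ℕ} {F : Ham n} {C₃ C₄ C₅ Cc : ℝ} (h1 : HypH1 F) (h3 : HypH3 F 0 C₃ C₄ C₅)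
    (hCc : 0 ≤ Cc) (hlow : ∀ x y t P, -Cc ≤ F x y t P 0) {L T : ℝ} (hL : 0 ≤ L) (hT : 0 ≤ T)
    (x : Euc n) (y t y' s : ℝ) (P : Euc n) (Q : ℝ) (hts : 2 * C₄ * |t - s| ≤ 1)
    (hF : F x y' s P Q ≤ L + T) :
    |F x y t P Q - F x y' s P Q| ≤ C₃ * |Q| * |y - y'|
      + 2 * C₄ * |t - s| * (1 + |Q| + (L + Cc + C₅ * |Q| + T)) := by
  have hC4 := h3.2.1
  have hC5 := h3.2.2.1
  have a1 := h3_y h1 h3 x y y' t P Q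
  have a2 := h3_t h1 h3 x y' t s P Q hts
  have a3 := h3_q h1 h3 x y' s P Q 0
  have a4 := hlow x y' s P
  rw [sub_zero] at a3
  have hCQ : 0 ≤ C₅ * |Q| := by positivity
  have a5 : |F x y' s P Q| ≤ L + Cc + C₅ * |Q| + T := by
    have := abs_le.1 a3
    rw [abs_le]; constructor <;> linarith
  have a6 : 2 * C₄ * |t - s| * (1 + |Q| + |F x y' s P Q|) ≤
      2 * C₄ * |t - s| * (1 + |Q| + (L + Cc + C₅ * |Q| + T)) := by gcongr
  have a7 := abs_sub_le (F x y t P Q) (F x y' t P Q) (F x y' s P Q)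
  linarith

lemma alg_est {C₃ C₄ C₅ Cc L R c a b Q : ℝ} (h3 : 0 ≤ C₃) (h4 : 0 ≤ C₄) (h5 : 0 ≤ C₅)
    (hCc : 0 ≤ Cc) (hL : 0 ≤ L) (hR : 0 ≤ R) (hc : 0 ≤ c) (ha : 0 ≤ a) (hb : 0 ≤ b)
    (hQ : Q ≤ R + 2 * c * a) :
    C₃ * Q * a + 2 * C₄ * b * (1 + Q + (L + Cc + C₅ * Q + 2 * c * b)) ≤
      (C₃ * R + 2 * C₄ * (1 + L + Cc + (1 + C₅) * R)) * (a + b)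
        + (2 * C₃ + 4 * C₄ * (2 + C₅)) * (c * (a ^ 2 + b ^ 2)) := by
  have s1 : C₃ * Q * a + 2 * C₄ * b * (1 + Q + (L + Cc + C₅ * Q + 2 * c * b)) ≤
      C₃ * (R + 2 * c * a) * a + 2 * C₄ * b * (1 + (R + 2 * c * a)
        + (L + Cc + C₅ * (R + 2 * c * a) + 2 * c * b)) := by gcongr
  refine s1.trans ?_
  have hab : a * b ≤ a ^ 2 + b ^ 2 := by nlinarith [sq_nonneg (a - b)]
  have g1 : 0 ≤ C₃ * R * b := by positivity
  have g2 : 0 ≤ 2 * C₄ * (1 + L + Cc + (1 + C₅) * R) * a := by positivity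
  have g3 : 0 ≤ C₃ * c * b ^ 2 := by positivity
  have g4 : 4 * C₄ * (1 + C₅) * c * (a * b) ≤ 4 * C₄ * (1 + C₅) * c * (a ^ 2 + b ^ 2) := by
    gcongr
  have g5 : 0 ≤ 4 * C₄ * c * a ^ 2 := by positivity
  nlinarith

lemma pen_bounds {n : ℕ} {K M d d' : ℝ} {z z' : Dom n} (hK : 0 ≤ K) (hM : 0 < M) (hd : 0 < d)
    (hd' : 0 < d') (ht : 0 ≤ z.2.2)
    (h : penE K (d ^ 2 / (2 * M)) z z' + penX (d' ^ 2 / (2 * M)) z z' ≤ 2 * M) :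
    |z.2.1 - z'.2.1| ≤ d ∧ |z.2.2 - z'.2.2| ≤ d ∧ ‖z.1 - z'.1‖ ≤ d' := by
  have e1 : 0 ≤ penE K (d ^ 2 / (2 * M)) z z' := by unfold penE; positivity
  have e2 : 0 ≤ penX (d' ^ 2 / (2 * M)) z z' := by unfold penX; positivity
  have f1 : penE K (d ^ 2 / (2 * M)) z z' ≤ 2 * M := by linarith
  have f2 : penX (d' ^ 2 / (2 * M)) z z' ≤ 2 * M := by linarith
  unfold penE at f1
  unfold penX at f2
  rw [div_le_iff₀ (by positivity), mul_div_cancel₀ _ (by positivity)] at f1 f2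
  have hexp : 1 ≤ Real.exp (K * z.2.2) := Real.one_le_exp (mul_nonneg hK ht)
  have f3 : (z.2.1 - z'.2.1) ^ 2 + (z.2.2 - z'.2.2) ^ 2 ≤ d ^ 2 := by
    have : 0 ≤ (z.2.1 - z'.2.1) ^ 2 + (z.2.2 - z'.2.2) ^ 2 := by positivity
    nlinarith
  refine ⟨?_, ?_, ?_⟩
  · exact abs_le_of_sq_le_sq (by nlinarith [sq_nonneg (z.2.2 - z'.2.2)]) hd.le
  · exact abs_le_of_sq_le_sq (by nlinarith [sq_nonneg (z.2.1 - z'.2.1)]) hd.le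
  · exact le_of_sq_le_sq f2 hd'.le

lemma xi_norm_le {n : ℕ} {a b : Euc n} {y t q r : ℝ} (h1 : ‖a‖ ≤ r) (h2 : |y| ≤ r) (h3 : |t| ≤ r)
    (h4 : ‖b‖ ≤ r) (h5 : |q| ≤ r) : ((a, y, t, b, q) : Xi n) ∈ Metric.closedBall (0 : Xi n) r := by
  rw [mem_closedBall_zero_iff]
  simp only [Prod.norm_mk, sup_le_iff, Real.norm_eq_abs]
  exact ⟨h1, h2, h3, h4, h5⟩

set_option maxHeartbeats 1600000 in
lemma main_lemma {n : ℕ} {F : Ham n} {S : Set (Ham n)} {C₃ C₄ C₅ : ℝ} (h1 : HypH1 F)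
    (h3 : HypH3 F 0 C₃ C₄ C₅) (hFS : F ∈ S)
    (h2 : ∀ R : ℝ, 0 < R → ∃ C₁ C₂ : ℝ, 0 < C₁ ∧ 0 < C₂ ∧
      ∀ G ∈ S, ∀ x y t px py, |py| ≤ R → C₁ * ‖px‖ - C₂ ≤ G x y t px py)
    (px0 : Euc n) (py0 lam : ℝ) (hcell : CellOk F px0 py0 lam) {ε : ℝ} (hε : 0 < ε) :
    ∃ ρ > 0, ∃ R', ∀ G ∈ S, (∀ ξ ∈ Metric.closedBall (0 : Xi n) R', |unc G ξ - unc F ξ| ≤ ρ) →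
      ∀ px py, ‖px - px0‖ ≤ ρ → |py - py0| ≤ ρ → ∀ mu, CellOk G px py mu → |mu - lam| ≤ 4 * ε := by
  obtain ⟨⟨u, ⟨Mu, hMu⟩, hup, hu⟩, ⟨v, ⟨Mv, hMv⟩, hvp, hv⟩⟩ := hcell
  obtain ⟨M, hM1, hub, hvb⟩ : ∃ M : ℝ, 1 ≤ M ∧ (∀ z, |u z| ≤ M) ∧ (∀ z, |v z| ≤ M) :=
    ⟨max 1 (max Mu Mv), le_max_left _ _,
      fun z => (hMu z).trans ((le_max_left _ _).trans (le_max_right _ _)),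
      fun z => (hMv z).trans ((le_max_right _ _).trans (le_max_right _ _))⟩
  have hM : 0 < M := by linarith
  have hC3 := h3.1
  have hC4 := h3.2.1
  have hC5 := h3.2.2.1
  obtain ⟨C10, Cc, hC10, hCc, hlow0⟩ := h2 1 one_pos
  have hlow : ∀ x y t P, -Cc ≤ F x y t P 0 := fun x y t P => by
    have := hlow0 F hFS x y t P 0 (by simp)
    have h : 0 ≤ C10 * ‖P‖ := by positivity
    linarith
  obtain ⟨R, hRdef⟩ : ∃ R, R = |py0| + 1 := ⟨_, rfl⟩
  have hR : 0 < R := by rw [hRdef]; positivity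
  obtain ⟨L, hLdef⟩ : ∃ L, L = |lam| + 3 * ε := ⟨_, rfl⟩
  have hL : 0 ≤ L := by rw [hLdef]; positivity
  have hlamL : lam + 3 * ε ≤ L := by rw [hLdef]; linarith [le_abs_self lam]
  obtain ⟨K, hKdef⟩ : ∃ K, K = 2 * C₃ + 4 * C₄ * (2 + C₅) := ⟨_, rfl⟩
  have hK : 0 ≤ K := by rw [hKdef]; positivity
  obtain ⟨Bc, hBdef⟩ : ∃ Bc, Bc = C₃ * R + 2 * C₄ * (1 + L + Cc + (1 + C₅) * R) := ⟨_, rfl⟩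
  have hB : 0 ≤ Bc := by rw [hBdef]; positivity
  obtain ⟨J, hJ⟩ := exists_nat_ge (6 * M / ε)
  have hJM : 6 * M ≤ ε * J := by rw [div_le_iff₀ hε] at hJ; linarith
  have hJ0 : 0 < J := by
    rcases Nat.eq_zero_or_pos J with h | h
    · rw [h] at hJM; simp at hJM; linarith
    · exact h
  obtain ⟨d, hd, hd1, hdB, hd4⟩ : ∃ d : ℝ, 0 < d ∧ d ≤ 1 ∧ Bc * (d + d) ≤ ε ∧ 2 * C₄ * d ≤ 1 := by
    refine ⟨min 1 (min (ε / (2 * Bc + 1)) (1 / (2 * C₄ + 1))), by positivity, min_le_left _ _,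
      ?_, ?_⟩
    · have h : min 1 (min (ε / (2 * Bc + 1)) (1 / (2 * C₄ + 1))) ≤ ε / (2 * Bc + 1) :=
        (min_le_right _ _).trans (min_le_left _ _)
      have h0 : 0 ≤ min 1 (min (ε / (2 * Bc + 1)) (1 / (2 * C₄ + 1))) := by positivity
      rw [le_div_iff₀ (by positivity)] at h
      nlinarith
    · have h : min 1 (min (ε / (2 * Bc + 1)) (1 / (2 * C₄ + 1))) ≤ 1 / (2 * C₄ + 1) :=
        (min_le_right _ _).trans (min_le_right _ _)
      have h0 : 0 ≤ min 1 (min (ε / (2 * Bc + 1)) (1 / (2 * C₄ + 1))) := by positivity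
      rw [le_div_iff₀ (by positivity)] at h
      nlinarith
  obtain ⟨δ, hδdef⟩ : ∃ δ, δ = d ^ 2 / (2 * M) := ⟨_, rfl⟩
  have hδ : 0 < δ := by rw [hδdef]; positivity
  have hδ1 : δ ≤ 1 := by rw [hδdef, div_le_one (by positivity)]; nlinarith
  obtain ⟨D, hDdef⟩ : ∃ D, D = 2 * Real.exp (K * (2 * J)) * d / δ := ⟨_, rfl⟩
  have hD : 0 < D := by rw [hDdef]; positivity
  obtain ⟨C1, C2, hC1, hC2, hcoer⟩ := h2 (R + D) (by positivity)
  obtain ⟨Rp, hRpdef⟩ : ∃ Rp, Rp = (L + D + C2) / C1 := ⟨_, rfl⟩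
  have hRp : 0 < Rp := by rw [hRpdef]; positivity
  have hcoer' : ∀ G ∈ S, ∀ x y t P Q, |Q| ≤ R + D → G x y t P Q ≤ L + D → ‖P‖ ≤ Rp := by
    intro G hG x y t P Q hQ hle
    have := hcoer G hG x y t P Q hQ
    rw [hRpdef, le_div_iff₀ hC1]; linarith
  obtain ⟨R', hR'def⟩ : ∃ R' : ℝ, R' = n + 1 + 2 * J + Rp + 1 + R + D := ⟨_, rfl⟩
  have hn0 : (0 : ℝ) ≤ n := by positivity
  have hJ0' : (0 : ℝ) < J := by exact_mod_cast hJ0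
  have hFc : Continuous (unc F) := h1.1
  obtain ⟨r, hr, hunif⟩ := Metric.uniformContinuousOn_iff.1
    ((isCompact_closedBall (0 : Xi n) R').uniformContinuousOn_of_continuous hFc.continuousOn) ε hε
  obtain ⟨d', hd', hd'1, hd'r⟩ : ∃ d' : ℝ, 0 < d' ∧ d' ≤ 1 ∧ d' ≤ r / 2 :=
    ⟨min 1 (r / 2), by positivity, min_le_left _ _, min_le_right _ _⟩
  obtain ⟨η, hηdef⟩ : ∃ η, η = d' ^ 2 / (2 * M) := ⟨_, rfl⟩
  have hη : 0 < η := by rw [hηdef]; positivity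
  have hη1 : η ≤ 1 := by rw [hηdef, div_le_one (by positivity)]; nlinarith
  obtain ⟨ρ, hρ, hρε, hρ1, hρr⟩ : ∃ ρ : ℝ, 0 < ρ ∧ ρ ≤ ε ∧ ρ ≤ 1 ∧ ρ ≤ r / 2 :=
    ⟨min ε (min 1 (r / 2)), by positivity, min_le_left _ _,
      (min_le_right _ _).trans (min_le_left _ _), (min_le_right _ _).trans (min_le_right _ _)⟩
  -- the basic estimate at a maximum point
  have core : ∀ G ∈ S, (∀ ξ ∈ Metric.closedBall (0 : Xi n) R', |unc G ξ - unc F ξ| ≤ ρ) →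
      ∀ px py, ‖px - px0‖ ≤ ρ → |py - py0| ≤ ρ → ∀ (z z' : Dom n) (ξ : Euc n) (q τ : ℝ),
      0 < z.2.2 → z.2.2 < 2 * J → ‖z.1‖ ≤ n → 0 ≤ z.2.1 → z.2.1 ≤ 1 →
      penE K δ z z' + penX η z z' ≤ 2 * M →
      |q| = 2 * Real.exp (K * z.2.2) * |z.2.1 - z'.2.1| / δ →
      |τ| = 2 * Real.exp (K * z.2.2) * |z.2.2 - z'.2.2| / δ →
      (F z'.1 z'.2.1 z'.2.2 (px0 + ξ) (py0 + q) ≤ lam + |τ| ∨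
        G z.1 z.2.1 z.2.2 (px + ξ) (py + q) ≤ lam + ε + |τ|) →
      |G z.1 z.2.1 z.2.2 (px + ξ) (py + q) - F z'.1 z'.2.1 z'.2.2 (px0 + ξ) (py0 + q)|
        ≤ 3 * ε + K * penE K δ z z' := by
    rintro G hG hclose px py hpx hpy ⟨x, y, t⟩ ⟨x', y', s⟩ ξ q τ ht0 ht1 hx hy0 hy1 hpen hq hτ hor
    have hpb := pen_bounds (d := d) (d' := d') hK hM hd hd' ht0.le (by rw [← hδdef, ← hηdef]; exact hpen)
    simp only at ht0 ht1 hx hy0 hy1 hq hτ hor hpb ⊢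
    obtain ⟨hby, hbt, hbx⟩ := hpb
    have hexp : Real.exp (K * t) ≤ Real.exp (K * (2 * J)) :=
      Real.exp_le_exp.2 (mul_le_mul_of_nonneg_left ht1.le hK)
    have hqD : |q| ≤ D := by rw [hq, hDdef]; gcongr
    have hτD : |τ| ≤ D := by rw [hτ, hDdef]; gcongr
    have hpyR : |py| ≤ R := by
      have := abs_sub_abs_le_abs_sub py py0
      rw [hRdef]; linarith
    have hQ0q : |py0 + q| ≤ R + |q| := by
      have := abs_add_le py0 q
      rw [hRdef]; linarith
    have hQ0 : |py0 + q| ≤ R + D := by linarith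
    have hQ : |py + q| ≤ R + D := by
      have := abs_add_le py q
      linarith
    have hdiff : ‖(px + ξ) - (px0 + ξ)‖ ≤ ρ := by
      rw [add_sub_add_right_eq_sub]; exact hpx
    have hPP : ‖px0 + ξ‖ ≤ Rp + 1 ∧ ‖px + ξ‖ ≤ Rp + 1 := by
      rcases hor with hor | hor
      · have h := hcoer' F hFS x' y' s (px0 + ξ) (py0 + q) hQ0 (by linarith)
        have := norm_sub_norm_le (px + ξ) (px0 + ξ)
        constructor <;> linarith
      · have h := hcoer' G hG x y t (px + ξ) (py + q) hQ (by linarith)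
        have := norm_sub_norm_le (px0 + ξ) (px + ξ)
        rw [norm_sub_rev] at this
        constructor <;> linarith
    obtain ⟨hP0, hP⟩ := hPP
    have hx' : ‖x'‖ ≤ n + 1 := by
      have := norm_sub_norm_le x' x
      rw [norm_sub_rev] at this
      linarith
    have mem1 : ((x, y, t, px + ξ, py + q) : Xi n) ∈ Metric.closedBall (0 : Xi n) R' := by
      refine xi_norm_le ?_ ?_ ?_ ?_ ?_ <;> rw [hR'def]
      · linarith
      · rw [abs_of_nonneg hy0]; linarith
      · rw [abs_of_nonneg ht0.le]; linarith
      · linarith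
      · linarith
    have mem2 : ((x', y, t, px0 + ξ, py0 + q) : Xi n) ∈ Metric.closedBall (0 : Xi n) R' := by
      refine xi_norm_le ?_ ?_ ?_ ?_ ?_ <;> rw [hR'def]
      · linarith
      · rw [abs_of_nonneg hy0]; linarith
      · rw [abs_of_nonneg ht0.le]; linarith
      · linarith
      · linarith
    have e1 : |G x y t (px + ξ) (py + q) - F x y t (px + ξ) (py + q)| ≤ ε :=
      (hclose _ mem1).trans hρε
    have e2 : |F x y t (px + ξ) (py + q) - F x' y t (px0 + ξ) (py0 + q)| ≤ ε := by
      refine (hunif _ mem1 _ mem2 ?_).le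
      refine lt_of_le_of_lt ?_ (half_lt_self hr)
      rw [dist_eq_norm]
      simp only [Prod.mk_sub_mk, Prod.norm_mk, sup_le_iff, Real.norm_eq_abs, sub_self, abs_zero]
      refine ⟨by linarith, by positivity, by positivity, by linarith, ?_⟩
      rw [add_sub_add_right_eq_sub]; linarith
    have hts : 2 * C₄ * |t - s| ≤ 1 := le_trans (by gcongr) hd4
    have halg : C₃ * |py0 + q| * |y - y'|
      + 2 * C₄ * |t - s| * (1 + |py0 + q| + (L + Cc + C₅ * |py0 + q| + |τ|)) ≤
        ε + K * penE K δ (x, y, t) (x', y', s) := by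
      have hc : 0 ≤ Real.exp (K * t) / δ := by positivity
      have h7 := alg_est (Q := |py0 + q|) hC3 hC4 hC5 hCc.le hL hR.le hc (abs_nonneg (y - y'))
        (abs_nonneg (t - s)) (by rw [hq] at hQ0q; convert hQ0q using 2; ring)
      rw [← hBdef, ← hKdef] at h7
      have h8 : 2 * (Real.exp (K * t) / δ) * |t - s| = |τ| := by rw [hτ]; ring
      have h9 : Real.exp (K * t) / δ * (|y - y'| ^ 2 + |t - s| ^ 2) =
          penE K δ (x, y, t) (x', y', s) := by
        simp only [penE, sq_abs]; ring
      rw [h8, h9] at h7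
      have h10 : Bc * (|y - y'| + |t - s|) ≤ Bc * (d + d) := by gcongr
      linarith
    have e3 : |F x' y t (px0 + ξ) (py0 + q) - F x' y' s (px0 + ξ) (py0 + q)| ≤
        ε + K * penE K δ (x, y, t) (x', y', s) := by
      rcases hor with hor | hor
      · exact (ham_est h1 h3 hCc.le hlow hL (abs_nonneg τ) x' y t y' s _ _ hts
          (by linarith)).trans halg
      · rw [abs_sub_comm]
        have h := ham_est h1 h3 hCc.le hlow hL (abs_nonneg τ) x' y' s y t (px0 + ξ) (py0 + q)
          (by rw [abs_sub_comm]; exact hts) (by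
            have := abs_le.1 e1
            have := abs_le.1 e2
            linarith)
        rw [abs_sub_comm y' y, abs_sub_comm s t] at h
        exact h.trans halg
    have := abs_sub_le (G x y t (px + ξ) (py + q)) (F x y t (px + ξ) (py + q))
      (F x' y' s (px0 + ξ) (py0 + q))
    have := abs_sub_le (F x y t (px + ξ) (py + q)) (F x' y t (px0 + ξ) (py0 + q))
      (F x' y' s (px0 + ξ) (py0 + q))
    linarith
  refine ⟨ρ, hρ, R', ?_⟩
  rintro G hG hclose px py hpx hpy mu ⟨⟨uG, -, huGp, huG⟩, ⟨vG, -, hvGp, hvG⟩⟩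
  rw [abs_le]
  constructor
  · by_contra hcon
    push Not at hcon
    obtain ⟨z, z', ξ, q, τ, ht0, ht1, hx, hy0, hy1, hpen, hq, hτ, hsub, hsup⟩ :=
      doubling_super hv huG hvp huGp hM hε hK hδ hδ1 hη hη1 hJ0 hJM hvb
    have hpE : 0 ≤ K * penE K δ z z' := mul_nonneg hK (by unfold penE; positivity)
    have := abs_le.1 (core G hG hclose px py hpx hpy z z' ξ q τ ht0 ht1 hx hy0 hy1 hpen hq hτ
      (Or.inr (by
        have := neg_abs_le τ
        linarith)))
    linarith
  · obtain ⟨z, z', ξ, q, τ, ht0, ht1, hx, hy0, hy1, hpen, hq, hτ, hsub, hsup⟩ :=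
      doubling_sub hu hvG hup hvGp hM hε hK hδ hδ1 hη hη1 hJ0 hJM hub
    have := abs_le.1 (core G hG hclose px py hpx hpy z z' ξ q τ ht0 ht1 hx hy0 hy1 hpen hq hτ
      (Or.inl (by
        have := neg_abs_le τ
        linarith)))
    linarith
/-- If F_k, F satisfy (H1), (H2') and (H3) with l = 0 uniformly in k,
and F_k → F locally uniformly, then the homogenized Hamiltonians F̄_k converge locally
uniformly to F̄. -/
theorem statement16 {n : ℕ} (hn : 0 < n) (Fk : ℕ → Ham n) (F : Ham n)
    (h1k : ∀ k, HypH1 (Fk k)) (h1 : HypH1 F)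
    (h2unif : ∀ R : ℝ, 0 < R → ∃ C₁ C₂ : ℝ, 0 < C₁ ∧ 0 < C₂ ∧
      (∀ k x y t px py, |py| ≤ R → C₁ * ‖px‖ - C₂ ≤ Fk k x y t px py) ∧
      (∀ x y t px py, |py| ≤ R → C₁ * ‖px‖ - C₂ ≤ F x y t px py))
    (h3unif : ∃ C₃ C₄ C₅ : ℝ, (∀ k, HypH3 (Fk k) 0 C₃ C₄ C₅) ∧ HypH3 F 0 C₃ C₄ C₅)
    (hconv : TendstoLocallyUniformly
      (fun (k : ℕ) (ξ : Xi n) => Fk k ξ.1 ξ.2.1 ξ.2.2.1 ξ.2.2.2.1 ξ.2.2.2.2)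
      (fun ξ : Xi n => F ξ.1 ξ.2.1 ξ.2.2.1 ξ.2.2.2.1 ξ.2.2.2.2) atTop)
    (Fbark : ℕ → Euc n × ℝ → ℝ) (Fbar : Euc n × ℝ → ℝ)
    (hFbark : ∀ (k : ℕ) (px : Euc n) (py : ℝ), CellOk (Fk k) px py (Fbark k (px, py)))
    (hFbar : ∀ (px : Euc n) (py : ℝ), CellOk F px py (Fbar (px, py))) :
    TendstoLocallyUniformly Fbark Fbar atTop := by
  obtain ⟨C₃, C₄, C₅, -, h3⟩ := h3unif
  let S : Set (Ham n) := insert F (Set.range Fk)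
  have h2 : ∀ R : ℝ, 0 < R → ∃ C₁ C₂ : ℝ, 0 < C₁ ∧ 0 < C₂ ∧
      ∀ G ∈ S, ∀ x y t px py, |py| ≤ R → C₁ * ‖px‖ - C₂ ≤ G x y t px py := by
    intro R hR
    obtain ⟨C₁, C₂, h1', h2', hk, hF⟩ := h2unif R hR
    refine ⟨C₁, C₂, h1', h2', ?_⟩
    rintro G (rfl | ⟨k, rfl⟩)
    · exact hF
    · exact hk k
  have hFS : F ∈ S := Set.mem_insert _ _
  rw [Metric.tendstoLocallyUniformly_iff]
  rintro ε hε ⟨px0, py0⟩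
  obtain ⟨ρ, hρ, R', hmain⟩ := main_lemma h1 h3 hFS h2 px0 py0 (Fbar (px0, py0)) (hFbar px0 py0)
    (ε := ε / 12) (by positivity)
  refine ⟨Metric.closedBall (px0, py0) ρ, Metric.closedBall_mem_nhds _ hρ, ?_⟩
  have hun := (tendstoLocallyUniformlyOn_iff_tendstoUniformlyOn_of_compact
    (isCompact_closedBall (0 : Xi n) R')).1 (hconv.tendstoLocallyUniformlyOn (s := Metric.closedBall (0 : Xi n) R'))
  rw [Metric.tendstoUniformlyOn_iff] at hun
  filter_upwards [hun ρ hρ] with k hk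
  rintro ⟨px, py⟩ hp
  rw [Metric.mem_closedBall, Prod.dist_eq, max_le_iff, dist_eq_norm, Real.dist_eq] at hp
  have a1 := hmain F hFS (fun ξ _ => by simp [hρ.le]) px py hp.1 hp.2 _ (hFbar px py)
  have a2 := hmain (Fk k) (Set.mem_insert_of_mem _ ⟨k, rfl⟩) (fun ξ hξ => by
    have := (hk ξ hξ).le
    rw [Real.dist_eq, abs_sub_comm] at this
    exact this) px py hp.1 hp.2 _ (hFbark k px py)
  rw [Real.dist_eq]
  have a3 := abs_sub_le (Fbar (px, py)) (Fbar (px0, py0)) (Fbark k (px, py))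
  rw [abs_sub_comm (Fbar (px0, py0))] at a3
  linarith
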